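/- Let X be a real Hilbert space and c : X × X → ℝ a continuous symmetric bilinear form satisfying the inf-sup condition on X with constant γ > 0. Let S be a closed subspace of X on which c also satisfies the inf-sup condition with some constant γ_S > 0, and let A = {x ∈ X : c(x, s) = 0 for all s ∈ S} be the c-orthogonal complement of S. Then X is the direct sum of A and S: A + S = X and A ∩ S = {0}. -/

import Mathlib

/-- The inf-sup condition for a bilinear form `c` on a subspace `S` (given as a set)
with constant `γ`: for every `u ∈ S`, `γ‖u‖ ≤ sup {c(u,v) : v ∈ S, ‖v‖ ≤ 1}`. -/
def InfSupOn {X : Type*} [NormedAddCommGroup X] [InnerProductSpace ℝ X]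
    (c : X →L[ℝ] X →L[ℝ] ℝ) (S : Set X) (γ : ℝ) : Prop :=
  ∀ u ∈ S, γ * ‖u‖ ≤ sSup ((fun v => c u v) '' {v | v ∈ S ∧ ‖v‖ ≤ 1})

/-- If `c` satisfies the inf-sup condition on `S` with constant `γ`, then the functional `c u` is
bounded below on `S` by `γ * ‖u‖` for every `u ∈ S`. -/
theorem InfSupOn.mul_norm_le {X : Type*} [NormedAddCommGroup X] [InnerProductSpace ℝ X]
    {c : X →L[ℝ] X →L[ℝ] ℝ} {S : Submodule ℝ X} {γ : ℝ} (h : InfSupOn c (S : Set X) γ) (u : S) :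
    γ * ‖u‖ ≤ ‖c.bilinearComp S.subtypeL S.subtypeL u‖ := by
  refine (h u u.2).trans (csSup_le ⟨_, 0, by simp, rfl⟩ ?_)
  rintro _ ⟨v, ⟨hv, hv1⟩, rfl⟩
  have hle := (c.bilinearComp S.subtypeL S.subtypeL u).le_opNorm ⟨v, hv⟩
  calc c u v ≤ ‖c.bilinearComp S.subtypeL S.subtypeL u‖ * ‖v‖ := (le_abs_self _).trans hle
    _ ≤ _ := mul_le_of_le_one_right (norm_nonneg _) hv1

open InnerProductSpace in
/-- A symmetric bounded bilinear form on a Hilbert space that is bounded below represents every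
bounded linear functional. -/
theorem surjective_of_symm_of_bounded_below {V : Type*} [NormedAddCommGroup V]
    [InnerProductSpace ℝ V] [CompleteSpace V] (B : V →L[ℝ] V →L[ℝ] ℝ)
    (hsymm : ∀ u v, B u v = B v u) {γ : ℝ} (hγ : 0 < γ) (hB : ∀ u, γ * ‖u‖ ≤ ‖B u‖) :
    Function.Surjective B := by
  let T : V →L[ℝ] V := continuousLinearMapOfBilin (𝕜 := ℝ) B
  have hT (u v : V) : inner ℝ (T u) v = B u v := continuousLinearMapOfBilin_apply B u v
  have hTB (u : V) : ‖B u‖ ≤ ‖T u‖ := by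
    refine (B u).opNorm_le_bound (norm_nonneg _) fun v => ?_
    rw [← hT]
    exact norm_inner_le_norm _ _
  have hanti : AntilipschitzWith (Real.toNNReal γ⁻¹) T := by
    refine T.antilipschitz_of_bound fun u => ?_
    rw [Real.coe_toNNReal _ (inv_nonneg.2 hγ.le), inv_mul_eq_div, le_div_iff₀ hγ, mul_comm]
    exact (hB u).trans (hTB u)
  have hclosed : IsClosed (T.range : Set V) :=
    hanti.isClosed_range T.uniformContinuous
  have : CompleteSpace T.range := hclosed.completeSpace_coe
  have htop : T.range = ⊤ := by
    rw [← Submodule.orthogonal_eq_bot_iff, Submodule.eq_bot_iff]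
    intro w hw
    have hBw : B w = 0 := by
      ext u
      rw [hsymm, ← hT]
      exact hw _ ⟨u, rfl⟩
    have hle := hB w
    rw [hBw, norm_zero] at hle
    exact norm_le_zero_iff.1 (nonpos_of_mul_nonpos_right hle hγ)
  intro f
  obtain ⟨u, hu⟩ : (toDual ℝ V).symm f ∈ T.range := htop ▸ Submodule.mem_top
  refine ⟨u, ?_⟩
  ext v
  rw [← hT, ← toDual_symm_apply (𝕜 := ℝ) (y := f)]
  exact congrArg (inner ℝ · v) hu

/-- Let `X` be a real Hilbert space and `c` a continuous symmetric
bilinear form satisfying the inf-sup condition on `X` with constant `γ > 0`.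
Let `S` be a closed subspace on which `c` also satisfies the inf-sup condition
with some constant `γ_S > 0`, and let `A = {x : c(x,s) = 0 ∀ s ∈ S}` be the
`c`-orthogonal complement of `S`. Then `X = A ⊕ S`: `A + S = X` and `A ∩ S = {0}`. -/
theorem c_orthogonal_complement_direct_sum
    {X : Type*} [NormedAddCommGroup X] [InnerProductSpace ℝ X] [CompleteSpace X]
    (c : X →L[ℝ] X →L[ℝ] ℝ)
    (hsymm : ∀ u v : X, c u v = c v u)
    (γ : ℝ) (hγ : 0 < γ)
    (hinfsup : InfSupOn c (Set.univ : Set X) γ)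
    (S : Submodule ℝ X) (hSclosed : IsClosed (S : Set X))
    (γS : ℝ) (hγS : 0 < γS)
    (hinfsupS : InfSupOn c (S : Set X) γS)
    (A : Set X) (hA : A = {x : X | ∀ s ∈ S, c x s = 0}) :
    (∀ x : X, ∃ a ∈ A, ∃ s ∈ S, x = a + s) ∧
      (∀ x : X, x ∈ A → x ∈ S → x = 0) := by
  subst hA
  have : CompleteSpace S := hSclosed.completeSpace_coe
  refine ⟨fun x => ?_, fun x hxA hxS => ?_⟩
  · obtain ⟨s, hs⟩ := surjective_of_symm_of_bounded_below
      (c.bilinearComp S.subtypeL S.subtypeL) (fun u v => hsymm u v) hγS hinfsupS.mul_norm_le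
      (c x ∘L S.subtypeL)
    refine ⟨x - s, fun t ht => ?_, s, s.2, (sub_add_cancel x s).symm⟩
    have hst : c s t = c x t := DFunLike.congr_fun hs (⟨t, ht⟩ : S)
    rw [map_sub, sub_apply, hst, sub_self]
  · have hle := hinfsupS.mul_norm_le ⟨x, hxS⟩
    have hzero : c.bilinearComp S.subtypeL S.subtypeL ⟨x, hxS⟩ = 0 := by
      ext t
      exact hxA t t.2
    rw [hzero, norm_zero] at hle
    exact norm_le_zero_iff.1 (nonpos_of_mul_nonpos_right hle hγS)
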